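/- For every density matrix ρ on ℂ^d, the coherence weight equals the optimal value of the semidefinite program: C_w(ρ) = sup { Re Tr(ρW) : W a d×d Hermitian matrix with Δ(W) ≤ 0 and W ≤ I }, where Δ(W) is the matrix obtained from W by setting all off-diagonal entries to zero, ≤ denotes the Loewner order (A ≤ B means B − A is positive semidefinite), and the supremum is attained. -/

import Mathlib

open Matrix BigOperators
open scoped ComplexOrder

noncomputable section

/-- A density matrix: positive semidefinite with unit trace. -/
def IsDensity {n : Type*} [Fintype n] (ρ : Matrix n n ℂ) : Prop :=
  ρ.PosSemidef ∧ ρ.trace = 1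

/-- A matrix is incoherent if it is diagonal in the fixed (standard) basis. -/
def IsIncoherent {n : Type*} (σ : Matrix n n ℂ) : Prop :=
  ∀ i j, i ≠ j → σ i j = 0

/-- The coherence weight of a state `ρ`. -/
noncomputable def cohWeight {n : Type*} [Fintype n] (ρ : Matrix n n ℂ) : ℝ :=
  sInf {s : ℝ | s ∈ Set.Icc (0 : ℝ) 1 ∧
    ∃ σ τ : Matrix n n ℂ,
      IsDensity σ ∧ IsIncoherent σ ∧ IsDensity τ ∧
      ρ = (1 - s) • σ + s • τ}

/-- The dephasing (complete decoherence) map: keep only the diagonal. -/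
def dephase {n : Type*} [DecidableEq n] (X : Matrix n n ℂ) : Matrix n n ℂ :=
  Matrix.diagonal (fun i => X i i)


lemma aux_factor {n : Type*} [Fintype n] [DecidableEq n] {A : Matrix n n ℂ}
    (hA : A.PosSemidef) : ∃ R Q N : Matrix n n ℂ, R.IsHermitian ∧ Q.IsHermitian ∧ N.IsHermitian ∧
      R * R = A ∧ R * Q = 1 - N ∧ Q * R = 1 - N ∧ N * N = N ∧ A * N = 0 := by
  have hs := hA.1.spectral_theorem
  have hnn := hA.eigenvalues_nonneg
  set φ := (Unitary.conjStarAlgAut ℂ (Matrix n n ℂ)) hA.1.eigenvectorUnitary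
  set ev := hA.1.eigenvalues
  have herm : ∀ f : n → ℝ, (φ (diagonal fun i => (f i : ℂ))).IsHermitian := by
    intro f
    have : star (φ (diagonal fun i => (f i : ℂ))) = φ (diagonal fun i => (f i : ℂ)) := by
      rw [← map_star, Matrix.star_eq_conjTranspose, diagonal_conjTranspose]
      congr 2
      ext i
      simp
    exact this
  refine ⟨φ (diagonal fun i => ((√(ev i) : ℝ) : ℂ)), φ (diagonal fun i => (((√(ev i))⁻¹ : ℝ) : ℂ)),
    φ (diagonal fun i => (((if ev i = 0 then 1 else 0 : ℝ)) : ℂ)), herm _, herm _, herm _,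
    ?_, ?_, ?_, ?_, ?_⟩
  · conv_rhs => rw [hs]
    rw [← map_mul, diagonal_mul_diagonal]
    congr 2
    ext i
    rw [← Complex.ofReal_mul, Real.mul_self_sqrt (hnn i)]
    rfl
  · rw [← map_mul, ← map_one φ, ← map_sub, diagonal_mul_diagonal, ← diagonal_one, diagonal_sub]
    congr 2
    ext i
    by_cases h : ev i = 0
    · simp [h]
    · have : (√(ev i)) ≠ 0 := by
        rw [Real.sqrt_ne_zero (hnn i)]; exact h
      simp [h, this]
  · rw [← map_mul, ← map_one φ, ← map_sub, diagonal_mul_diagonal, ← diagonal_one, diagonal_sub]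
    congr 2
    ext i
    by_cases h : ev i = 0
    · simp [h]
    · have : (√(ev i)) ≠ 0 := by
        rw [Real.sqrt_ne_zero (hnn i)]; exact h
      simp [h, this]
  · rw [← map_mul, diagonal_mul_diagonal]
    congr 2
    ext i
    by_cases h : ev i = 0 <;> simp [h]
  · conv_lhs => rw [hs]
    rw [← map_mul, diagonal_mul_diagonal, ← map_zero φ, ← diagonal_zero]
    congr 2
    ext i
    by_cases h : ev i = 0 <;> simp [h]

lemma aux_trace_mul_nonneg {n : Type*} [Fintype n] {A B : Matrix n n ℂ}
    (hA : A.PosSemidef) (hB : B.PosSemidef) : 0 ≤ ((A * B).trace).re := by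
  classical
  obtain ⟨R, -, -, hR, -, -, hRR, -⟩ := aux_factor hA
  have h := (hB.mul_mul_conjTranspose_same R).trace_nonneg
  rw [hR.eq, Matrix.trace_mul_comm, ← Matrix.mul_assoc, hRR] at h
  exact (Complex.le_def.1 h).1

lemma aux_compact {n : Type*} [Fintype n] :
    IsCompact {Z : Matrix n n ℂ | IsDensity Z} := by
  classical
  have htr : ∀ C : Matrix n n ℂ, (C * Cᴴ).trace = ((∑ i, ∑ j, ‖C i j‖ ^ 2 : ℝ) : ℂ) := by
    intro C
    simp [Matrix.trace, Matrix.mul_apply, Complex.mul_conj, Complex.normSq_eq_norm_sq]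
  have hK : IsCompact {C : Matrix n n ℂ | (C * Cᴴ).trace = 1} := by
    have hcl : IsClosed {C : Matrix n n ℂ | (C * Cᴴ).trace = 1} :=
      isClosed_eq (by fun_prop) continuous_const
    have hb : IsCompact (Set.univ.pi fun _ : n => Set.univ.pi fun _ : n =>
        Metric.closedBall (0 : ℂ) 1) :=
      isCompact_univ_pi fun _ => isCompact_univ_pi fun _ => isCompact_closedBall _ _
    refine IsCompact.of_isClosed_subset hb hcl ?_
    intro C hC i _ j _
    simp only [Set.mem_ofPred_eq, htr] at hC
    have hC' : (∑ i, ∑ j, ‖C i j‖ ^ 2 : ℝ) = 1 := by exact_mod_cast hC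
    have h1 : ‖C i j‖ ^ 2 ≤ ∑ j, ‖C i j‖ ^ 2 :=
      Finset.single_le_sum (f := fun j => ‖C i j‖ ^ 2) (fun _ _ => by positivity) (Finset.mem_univ j)
    have h2 : ∑ j, ‖C i j‖ ^ 2 ≤ ∑ i, ∑ j, ‖C i j‖ ^ 2 :=
      Finset.single_le_sum (f := fun i => ∑ j, ‖C i j‖ ^ 2) (fun _ _ => by positivity)
        (Finset.mem_univ i)
    simp only [Metric.mem_closedBall, dist_zero_right]
    nlinarith [norm_nonneg (C i j)]
  have himg := hK.image (f := fun C : Matrix n n ℂ => C * Cᴴ) (by fun_prop)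
  convert himg using 1
  ext Z
  simp only [Set.mem_ofPred_eq, Set.mem_image]
  constructor
  · rintro ⟨hZ, ht⟩
    obtain ⟨R, -, -, hR, -, -, hRR, -⟩ := aux_factor hZ
    refine ⟨R, ?_, ?_⟩ <;> rw [hR.eq, hRR]
    exact ht
  · rintro ⟨C, hC, rfl⟩
    exact ⟨posSemidef_self_mul_conjTranspose C, hC⟩

lemma aux_psd_smul {n : Type*} {A : Matrix n n ℂ} (hA : A.PosSemidef) {c : ℝ} (hc : 0 ≤ c) :
    (c • A).PosSemidef := hA.smul hc

lemma aux_minimax {ι : Type*} [Fintype ι] [Nonempty ι] {D : Set (ι → ℝ)} (hc : IsCompact D)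
    (hconv : Convex ℝ D) (hne : D.Nonempty) :
    ∃ x ∈ D, ∃ p : ι → ℝ, (∀ i, 0 ≤ p i) ∧ ∑ i, p i = 1 ∧
      ∃ g : ℝ, (∀ i, g ≤ x i) ∧ (∀ y ∈ D, ∃ i, y i ≤ g) ∧ ∀ y ∈ D, ∑ i, p i * y i ≤ g := by
  classical
  have hcont : Continuous fun x : ι → ℝ => Finset.univ.inf' Finset.univ_nonempty fun i => x i :=
    Continuous.finset_inf'_apply _ (fun i _ => continuous_apply i)
  obtain ⟨x, hxD, hx⟩ := hc.exists_isMaxOn hne hcont.continuousOn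
  set g := Finset.univ.inf' Finset.univ_nonempty fun i => x i with hg
  have hD : ∀ y ∈ D, ∃ i, y i ≤ g := by
    intro y hy
    by_contra! h
    have h1 : (Finset.univ.inf' Finset.univ_nonempty fun i => y i) ≤ g := hx hy
    have h2 : g < (Finset.univ.inf' Finset.univ_nonempty fun i => y i) := by
      rw [Finset.lt_inf'_iff]; intro i _; exact h i
    linarith
  have hO : {y : ι → ℝ | ∀ i, g < y i} = Set.univ.pi fun _ => Set.Ioi g := by
    ext y; simp
  obtain ⟨f, u, hf1, hf2⟩ := geometric_hahn_banach_open (s := {y : ι → ℝ | ∀ i, g < y i}) (t := D)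
    (by rw [hO]; exact convex_pi fun _ _ => convex_Ioi g)
    (by rw [hO]; exact isOpen_set_pi Set.finite_univ fun _ _ => isOpen_Ioi) hconv
    (by
      rw [Set.disjoint_left]
      intro y hy hyD
      obtain ⟨i, hi⟩ := hD y hyD
      exact absurd (hy i) (not_lt.2 hi))
  have hfe : ∀ y : ι → ℝ, f y = ∑ i, y i * f (Pi.single i 1) := by
    intro y
    conv_lhs => rw [pi_eq_sum_univ' y]
    rw [map_sum]
    refine Finset.sum_congr rfl fun i _ => ?_
    rw [map_smul, smul_eq_mul]
  have hq : ∀ i, f (Pi.single i 1) ≤ 0 := by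
    intro i
    by_contra! h
    have h0 := hf1 (fun _ => g + 1) (fun _ => by linarith)
    set t := (u - f (fun _ => g + 1)) / f (Pi.single i 1) with ht
    have htp : 0 ≤ t := div_nonneg (by linarith) h.le
    have h1 := hf1 ((fun _ => g + 1) + t • Pi.single i 1) (fun j => by
      have : 0 ≤ (Pi.single i (1 : ℝ) : ι → ℝ) j := by
        rw [Pi.single_apply]; split_ifs <;> norm_num
      simp only [Pi.add_apply, Pi.smul_apply, smul_eq_mul]
      nlinarith [mul_nonneg htp this])
    rw [map_add, map_smul, smul_eq_mul, ht, div_mul_cancel₀ _ h.ne'] at h1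
    linarith
  set s := ∑ i, - f (Pi.single i 1) with hs
  have hs0 : 0 ≤ s := Finset.sum_nonneg fun i _ => by linarith [hq i]
  have hcst : ∀ c : ℝ, f (fun _ => c) = - (c * s) := by
    intro c
    rw [hfe, hs, ← Finset.mul_sum, Finset.sum_neg_distrib]; ring
  have hu : - (g * s) ≤ u := by
    by_contra! h
    have hs1 : 0 < s + 1 := by linarith
    have h1 := hf1 (fun _ => g + (-(g * s) - u) / (s + 1)) (fun _ => by
      have : 0 < (-(g * s) - u) / (s + 1) := div_pos (by linarith) hs1
      linarith)
    rw [hcst] at h1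
    have h2 : (-(g * s) - u) / (s + 1) * (s + 1) = -(g * s) - u := div_mul_cancel₀ _ hs1.ne'
    have h3 : 0 < (-(g * s) - u) / (s + 1) := div_pos (by linarith) hs1
    nlinarith
  have hspos : 0 < s := by
    rcases hs0.lt_or_eq with h | h
    · exact h
    · exfalso
      have hz : ∀ i, f (Pi.single i 1) = 0 := by
        intro i
        have := (Finset.sum_eq_zero_iff_of_nonneg (s := Finset.univ)
          (f := fun i => - f (Pi.single i 1)) (fun i _ => by linarith [hq i])).1
          (by rw [← hs, ← h]) i (Finset.mem_univ i)
        linarith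
      have hz' : ∀ y, f y = 0 := by intro y; rw [hfe]; simp [hz]
      have a1 := hf1 (fun _ => g + 1) (fun _ => by linarith)
      have a2 := hf2 x hxD
      rw [hz'] at a1 a2
      linarith
  refine ⟨x, hxD, fun i => - f (Pi.single i 1) / s, fun i => div_nonneg (by linarith [hq i]) hs0,
    ?_, g, fun i => Finset.inf'_le _ (Finset.mem_univ i), hD, ?_⟩
  · rw [← Finset.sum_div, ← hs, div_self hspos.ne']
  · intro y hy
    have h1 := hf2 y hy
    rw [hfe] at h1
    have h2 : ∑ i, - f (Pi.single i 1) / s * y i = (- ∑ i, y i * f (Pi.single i 1)) / s := by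
      rw [← Finset.sum_neg_distrib, Finset.sum_div]
      exact Finset.sum_congr rfl fun i _ => by ring
    rw [h2, div_le_iff₀ hspos]
    linarith

lemma aux_density_le {n : Type*} [Fintype n] [DecidableEq n] {A : Matrix n n ℂ}
    (hA : A.IsHermitian) {g : ℝ} (h : ∀ Z : Matrix n n ℂ, IsDensity Z → ((A * Z).trace).re ≤ g) :
    (g • (1 : Matrix n n ℂ) - A).PosSemidef := by
  have hH : (g • (1 : Matrix n n ℂ) - A).IsHermitian := by
    refine IsHermitian.sub ?_ hA
    unfold IsHermitian
    rw [conjTranspose_smul]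
    simp
  refine PosSemidef.of_dotProduct_mulVec_nonneg hH fun x => ?_
  have him : (star x ⬝ᵥ (g • (1 : Matrix n n ℂ) - A) *ᵥ x).im = 0 := hH.im_star_dotProduct_mulVec_self x
  by_cases hx : x = 0
  · simp [hx]
  have hxx : 0 < star x ⬝ᵥ x := dotProduct_star_self_pos_iff.2 hx
  obtain ⟨hr, hi⟩ := Complex.lt_def.1 hxx
  set r := (star x ⬝ᵥ x).re with hrdef
  have hxr : star x ⬝ᵥ x = (r : ℂ) := Complex.ext (by simp [hrdef]) (by simpa using hi.symm)
  simp only [Complex.zero_re] at hr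
  have hZ : IsDensity (r⁻¹ • vecMulVec x (star x)) := by
    refine ⟨aux_psd_smul (posSemidef_vecMulVec_self_star x) (inv_nonneg.2 hr.le), ?_⟩
    rw [trace_smul, trace_vecMulVec, dotProduct_comm, hxr, Complex.real_smul, ← Complex.ofReal_mul,
      inv_mul_cancel₀ hr.ne']
    simp
  have h1 := h _ hZ
  rw [mul_smul_comm, trace_smul, mul_vecMulVec, trace_vecMulVec, dotProduct_comm, Complex.smul_re,
    smul_eq_mul] at h1
  have h2 : (star x ⬝ᵥ A *ᵥ x).re ≤ g * r := by
    rw [inv_mul_le_iff₀ hr] at h1; linarith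
  rw [Complex.le_def]
  refine ⟨?_, by simpa using him.symm⟩
  rw [sub_mulVec, dotProduct_sub, smul_mulVec, one_mulVec, dotProduct_smul, hxr]
  simp only [Complex.zero_re, Complex.sub_re, Complex.smul_re, smul_eq_mul, Complex.ofReal_re]
  linarith

lemma aux_psd_of_proj {n : Type*} [Fintype n] {N : Matrix n n ℂ} (hN : N.IsHermitian)
    (hNN : N * N = N) : N.PosSemidef := by
  have := posSemidef_self_mul_conjTranspose N
  rwa [hN.eq, hNN] at this

lemma aux_diag_sq {n : Type*} [Fintype n] {N : Matrix n n ℂ} (hN : N.IsHermitian) {i : n}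
    (h : (N * N) i i = 0) (j : n) : N j i = 0 := by
  have h1 : (N * N) i i = ((∑ j, ‖N j i‖ ^ 2 : ℝ) : ℂ) := by
    rw [Matrix.mul_apply]
    push_cast
    refine Finset.sum_congr rfl fun k _ => ?_
    rw [← hN.apply i k, mul_comm]
    simpa [Complex.normSq_eq_norm_sq] using Complex.mul_conj (N k i)
  rw [h1] at h
  have h2 : (∑ j, ‖N j i‖ ^ 2 : ℝ) = 0 := by exact_mod_cast h
  rw [Finset.sum_eq_zero_iff_of_nonneg (fun _ _ => by positivity)] at h2
  simpa using h2 j (Finset.mem_univ j)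

lemma aux_large {n : Type*} [Fintype n] {N : Matrix n n ℂ} (hN : N.PosSemidef) :
    ∃ t : ℝ, 0 ≤ t ∧ ∀ i, N i i ≠ 0 → 1 ≤ t * (N i i).re := by
  have hnn : ∀ i, 0 ≤ (N i i).re := fun i => (Complex.le_def.1 (hN.diag_nonneg (i := i))).1
  refine ⟨∑ i, ((N i i).re)⁻¹, Finset.sum_nonneg fun i _ => inv_nonneg.2 (hnn i), fun i hi => ?_⟩
  have hpos : 0 < (N i i).re := by
    refine lt_of_le_of_ne (hnn i) fun h => hi ?_
    exact Complex.ext h.symm (Complex.le_def.1 (hN.diag_nonneg (i := i))).2.symm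
  have : ((N i i).re)⁻¹ ≤ ∑ i, ((N i i).re)⁻¹ :=
    Finset.single_le_sum (f := fun i => ((N i i).re)⁻¹) (fun i _ => inv_nonneg.2 (hnn i))
      (Finset.mem_univ i)
  calc 1 = ((N i i).re)⁻¹ * (N i i).re := (inv_mul_cancel₀ hpos.ne').symm
    _ ≤ _ := by gcongr

lemma aux_core {n : Type*} [Fintype n] [DecidableEq n] [Nonempty n] {A : Matrix n n ℂ}
    (hA : A.PosSemidef) : ∃ (p : n → ℝ) (Y : Matrix n n ℂ), (∀ i, 0 ≤ p i) ∧
      (A - diagonal fun i => (p i : ℂ)).PosSemidef ∧ Y.PosSemidef ∧ (∀ i, 1 ≤ (Y i i).re) ∧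
      ((A * Y).trace).re ≤ ∑ i, p i := by
  classical
  obtain ⟨R, Q, N, hR, hQ, hN, hRR, hRQ, hQR, hNN, hAN⟩ := aux_factor hA
  have hNp := aux_psd_of_proj hN hNN
  obtain ⟨t, ht0, ht⟩ := aux_large hNp
  have hNre : ∀ i, 0 ≤ (N i i).re := fun i => (Complex.le_def.1 (hNp.diag_nonneg (i := i))).1
  by_cases hS : Nonempty {i // N i i = 0}
  swap
  · refine ⟨0, t • N, fun _ => le_rfl, by simpa using hA, aux_psd_smul hNp ht0, fun i => ?_, ?_⟩
    · have : N i i ≠ 0 := fun h => hS ⟨i, h⟩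
      simpa using ht i this
    · simp [hAN]
  have hNcol : ∀ i, N i i = 0 → ∀ j, N j i = 0 := fun i hi j => aux_diag_sq hN (by rw [hNN, hi]) j
  -- the linear map
  let ℓ : Matrix n n ℂ →ₗ[ℝ] ({i // N i i = 0} → ℝ) :=
    { toFun := fun Z i => ((Q * Z * Q) i i).re
      map_add' := by intro X Y; ext i; simp [Matrix.mul_add, Matrix.add_mul]
      map_smul' := by intro c X; ext i; simp }
  have hℓ : Continuous fun Z : Matrix n n ℂ => ℓ Z := by
    refine continuous_pi fun i => ?_
    change Continuous fun Z : Matrix n n ℂ => ((Q * Z * Q) i i).re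
    fun_prop
  have hdc : Convex ℝ {Z : Matrix n n ℂ | IsDensity Z} := by
    rintro X ⟨hX, hX1⟩ Y ⟨hY, hY1⟩ a b ha hb hab
    refine ⟨(aux_psd_smul hX ha).add (aux_psd_smul hY hb), ?_⟩
    rw [trace_add, trace_smul, trace_smul, hX1, hY1, ← add_smul, hab, one_smul]
  have hcard : (0 : ℝ) < Fintype.card n := by exact_mod_cast Fintype.card_pos
  have h1d : IsDensity (((Fintype.card n : ℝ)⁻¹) • (1 : Matrix n n ℂ)) := by
    refine ⟨aux_psd_smul PosSemidef.one (inv_nonneg.2 hcard.le), ?_⟩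
    rw [trace_smul, trace_one, Complex.real_smul, Complex.ofReal_inv, Complex.ofReal_natCast]
    exact inv_mul_cancel₀ (by exact_mod_cast hcard.ne')
  obtain ⟨x, ⟨Z, hZ, rfl⟩, p, hp0, hp1, g, hg1, hg2, hg3⟩ :=
    aux_minimax (aux_compact.image hℓ) (hdc.linear_image ℓ) ⟨_, _, h1d, rfl⟩
  have hgpos : 0 < g := by
    obtain ⟨i, hi⟩ := hg2 _ ⟨_, h1d, rfl⟩
    refine lt_of_lt_of_le ?_ hi
    change 0 < ((Q * (((Fintype.card n : ℝ)⁻¹) • (1 : Matrix n n ℂ)) * Q) i i).re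
    have e : (Q * (((Fintype.card n : ℝ)⁻¹) • (1 : Matrix n n ℂ)) * Q) =
        ((Fintype.card n : ℝ)⁻¹) • (Q * Q) := by simp
    rw [e, Matrix.smul_apply, Complex.smul_re, smul_eq_mul]
    refine mul_pos (inv_pos.2 hcard) ?_
    have hQQ : (Q * Q).PosSemidef := by
      have := posSemidef_self_mul_conjTranspose Q
      rwa [hQ.eq] at this
    obtain ⟨a1, a2⟩ := Complex.le_def.1 (hQQ.diag_nonneg (i := (i : n)))
    refine lt_of_le_of_ne a1 fun h => ?_
    have hz : (Q * Q) i i = 0 := Complex.ext h.symm a2.symm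
    have hcol := aux_diag_sq hQ hz
    have b1 : (R * Q) i i = 0 := by
      rw [Matrix.mul_apply]; simp [hcol]
    rw [hRQ, Matrix.sub_apply, i.2] at b1
    simp at b1
  -- extend p
  let q : n → ℝ := fun i => if h : N i i = 0 then p ⟨i, h⟩ else 0
  have hq0 : ∀ i, 0 ≤ q i := by
    intro i; simp only [q]; split_ifs with h
    · exact hp0 _
    · exact le_rfl
  have hqsum : ∀ F : n → ℝ, ∑ i, q i * F i = ∑ i : {i // N i i = 0}, p i * F i := by
    intro F
    rw [← Fintype.sum_subtype_add_sum_subtype (fun i => N i i = 0) (fun i => q i * F i)]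
    have z : ∑ i : {i // ¬ N i i = 0}, q i * F i = 0 :=
      Finset.sum_eq_zero fun i _ => by simp [q, i.2]
    rw [z, add_zero]
    exact Finset.sum_congr rfl fun i _ => by simp [q, i.2]
  have hq1 : ∑ i, q i = 1 := by
    have := hqsum fun _ => 1
    simpa [hp1] using this
  set P : Matrix n n ℂ := diagonal fun i => (q i : ℂ) with hP
  have hPh : P.IsHermitian := by
    rw [hP]; unfold IsHermitian; rw [diagonal_conjTranspose]; congr 1; ext i; simp
  have hNP : N * P = 0 := by
    ext j i
    rw [hP, mul_diagonal]
    by_cases h : N i i = 0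
    · simp [hNcol i h j]
    · simp [q, h]
  have hPN : P * N = 0 := by
    have := congrArg conjTranspose hNP
    rwa [conjTranspose_mul, hPh.eq, hN.eq, conjTranspose_zero] at this
  have hpsd1 : (g • (1 : Matrix n n ℂ) - Q * P * Q).PosSemidef := by
    refine aux_density_le ?_ fun X hX => ?_
    · unfold IsHermitian
      rw [conjTranspose_mul, conjTranspose_mul, hPh.eq, hQ.eq, Matrix.mul_assoc]
    · have h1 := hg3 _ ⟨X, hX, rfl⟩
      have h2 := hqsum fun i => ((Q * X * Q) i i).re
      have h3 : (Q * P * Q * X).trace = (P * (Q * X * Q)).trace := by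
        rw [Matrix.mul_assoc Q, Matrix.mul_assoc Q, Matrix.trace_mul_comm]
        simp only [Matrix.mul_assoc]
      rw [h3]
      refine le_trans (le_of_eq ?_) h1
      change _ = ∑ i : {i // N i i = 0}, p i * ((Q * X * Q) i i).re
      rw [← h2, Matrix.trace, Complex.re_sum]
      refine Finset.sum_congr rfl fun i _ => ?_
      rw [diag_apply, hP, diagonal_mul, Complex.re_ofReal_mul]
  have hpsd2 : (g • A - P).PosSemidef := by
    have h := hpsd1.mul_mul_conjTranspose_same R
    rw [hR.eq] at h
    convert h using 1
    have e : R * (Q * P * Q) * R = P := by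
      calc R * (Q * P * Q) * R = (R * Q) * P * (Q * R) := by simp only [Matrix.mul_assoc]
        _ = P := by
          rw [hRQ, hQR, Matrix.sub_mul, hNP, Matrix.mul_sub, Matrix.sub_mul]; simp [hPN]
    rw [Matrix.mul_sub, Matrix.sub_mul, e]
    simp [hRR]
  refine ⟨fun i => g⁻¹ * q i, g⁻¹ • (Q * Z * Q) + t • N,
    fun i => mul_nonneg (inv_nonneg.2 hgpos.le) (hq0 i), ?_, ?_, fun i => ?_, ?_⟩
  · have h := aux_psd_smul hpsd2 (inv_nonneg.2 hgpos.le)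
    convert h using 1
    rw [smul_sub, smul_smul, inv_mul_cancel₀ hgpos.ne', one_smul, hP]
    congr 1
    ext i j
    simp [diagonal_apply]
  · have h := hZ.1.mul_mul_conjTranspose_same Q
    rw [hQ.eq] at h
    exact (aux_psd_smul h (inv_nonneg.2 hgpos.le)).add (aux_psd_smul hNp ht0)
  · have h := hZ.1.mul_mul_conjTranspose_same Q
    rw [hQ.eq] at h
    have hd : 0 ≤ ((Q * Z * Q) i i).re := (Complex.le_def.1 (h.diag_nonneg (i := i))).1
    rw [Matrix.add_apply, Matrix.smul_apply, Matrix.smul_apply, Complex.add_re, Complex.smul_re,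
      Complex.smul_re, smul_eq_mul, smul_eq_mul]
    by_cases hi : N i i = 0
    · have h1 : g ≤ ((Q * Z * Q) i i).re := hg1 ⟨i, hi⟩
      have h2 : g⁻¹ * g ≤ g⁻¹ * ((Q * Z * Q) i i).re := by gcongr
      rw [inv_mul_cancel₀ hgpos.ne'] at h2
      simpa [hi] using h2
    · have h1 := ht i hi
      have h2 := mul_nonneg (inv_nonneg.2 hgpos.le) hd
      linarith
  · have hNZ := aux_trace_mul_nonneg hNp hZ.1
    have hPP : (1 - N) * (1 - N) = 1 - N := by
      simp [Matrix.sub_mul, Matrix.mul_sub, hNN]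
    have e : (A * (Q * Z * Q)).trace = 1 - (N * Z).trace := by
      calc (A * (Q * Z * Q)).trace = (((R * (R * Q)) * Z) * Q).trace := by
            rw [← hRR]; simp only [Matrix.mul_assoc]
        _ = ((Q * R) * (R * Q) * Z).trace := by
            rw [Matrix.trace_mul_comm]; simp only [Matrix.mul_assoc]
        _ = _ := by rw [hQR, hRQ, hPP, Matrix.sub_mul, trace_sub, Matrix.one_mul, hZ.2]
    rw [Matrix.mul_add, mul_smul_comm, mul_smul_comm, hAN, smul_zero, add_zero, trace_smul, e,
      ← Finset.mul_sum, hq1, Complex.smul_re, smul_eq_mul]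
    refine mul_le_mul_of_nonneg_left ?_ (inv_nonneg.2 hgpos.le)
    simp only [Complex.sub_re, Complex.one_re]
    linarith

lemma aux_dephase_density {n : Type*} [Fintype n] [DecidableEq n] {ρ : Matrix n n ℂ}
    (hρ : IsDensity ρ) : IsDensity (dephase ρ) :=
  ⟨posSemidef_diagonal_iff.2 fun _ => hρ.1.diag_nonneg, by
    have := hρ.2
    simpa [dephase, Matrix.trace] using this⟩

lemma aux_mem {n : Type*} [Fintype n] [DecidableEq n] {ρ : Matrix n n ℂ}
    (hρ : IsDensity ρ) (p : n → ℝ) (hp : ∀ i, 0 ≤ p i)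
    (h : (ρ - diagonal fun i => (p i : ℂ)).PosSemidef) :
    (1 - ∑ i, p i) ∈ {s : ℝ | s ∈ Set.Icc (0 : ℝ) 1 ∧
    ∃ σ τ : Matrix n n ℂ,
      IsDensity σ ∧ IsIncoherent σ ∧ IsDensity τ ∧
      ρ = (1 - s) • σ + s • τ} := by
  set m := ∑ i, p i with hm
  have hm0 : 0 ≤ m := Finset.sum_nonneg fun i _ => hp i
  set P : Matrix n n ℂ := diagonal fun i => (p i : ℂ) with hP
  have hPp : P.PosSemidef := posSemidef_diagonal_iff.2 fun i => by exact_mod_cast hp i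
  have hPt : P.trace = (m : ℂ) := by rw [hP, trace_diagonal, hm]; push_cast; rfl
  have htr : (ρ - P).trace = ((1 - m : ℝ) : ℂ) := by
    rw [trace_sub, hρ.2, hPt]; push_cast; rfl
  have hm1 : 0 ≤ 1 - m := by
    have := h.trace_nonneg
    rw [htr] at this
    exact_mod_cast this
  have hinc : ∀ f : n → ℂ, IsIncoherent (diagonal f) := fun f i j hij => diagonal_apply_ne _ hij
  refine ⟨⟨hm1, by linarith⟩, ?_⟩
  rcases hm0.eq_or_lt with h0 | h0
  · refine ⟨dephase ρ, ρ, aux_dephase_density hρ, hinc _, hρ, ?_⟩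
    rw [← h0]; simp
  have hσ : IsDensity (m⁻¹ • P) := by
    refine ⟨aux_psd_smul hPp (inv_nonneg.2 hm0), ?_⟩
    rw [trace_smul, hPt, Complex.real_smul, ← Complex.ofReal_mul, inv_mul_cancel₀ h0.ne']; simp
  have hσi : IsIncoherent (m⁻¹ • P) := by
    intro i j hij
    rw [Matrix.smul_apply, hP, hinc _ i j hij, smul_zero]
  have e1 : (1 - (1 - m)) • (m⁻¹ • P) = P := by
    rw [sub_sub_cancel, smul_smul, mul_inv_cancel₀ h0.ne', one_smul]
  rcases hm1.eq_or_lt with h1 | h1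
  · refine ⟨m⁻¹ • P, ρ, hσ, hσi, hρ, ?_⟩
    rw [e1, ← h1, zero_smul, add_zero]
    have : ρ - P = 0 := by
      rw [← h.trace_eq_zero_iff, htr, ← h1]; simp
    exact sub_eq_zero.1 this
  · refine ⟨m⁻¹ • P, (1 - m)⁻¹ • (ρ - P), hσ, hσi, ⟨aux_psd_smul h (inv_nonneg.2 hm1), ?_⟩, ?_⟩
    · rw [trace_smul, htr, Complex.real_smul, ← Complex.ofReal_mul, inv_mul_cancel₀ h1.ne']; simp
    · rw [e1, smul_smul, mul_inv_cancel₀ h1.ne', one_smul]; abel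

lemma aux_weak {n : Type*} [Fintype n] [DecidableEq n] {ρ : Matrix n n ℂ}
    (hρ : IsDensity ρ) (W : Matrix n n ℂ) (h1 : (-(dephase W)).PosSemidef)
    (h2 : ((1 : Matrix n n ℂ) - W).PosSemidef) : ((ρ * W).trace).re ≤ cohWeight ρ := by
  refine le_csInf ⟨1, by simpa using aux_mem hρ (fun _ => 0) (fun _ => le_rfl) (by simpa using hρ.1)⟩ ?_
  rintro s ⟨⟨hs0, hs1⟩, σ, τ, hσ, hσi, hτ, rfl⟩
  have a1 : ((σ * W).trace).re ≤ 0 := by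
    have := aux_trace_mul_nonneg hσ.1 h1
    have hd : σ = diagonal fun i => σ i i := by
      ext i j
      by_cases hij : i = j
      · subst hij; simp
      · rw [diagonal_apply_ne _ hij, hσi i j hij]
    have e : (σ * -(dephase W)).trace = - (σ * W).trace := by
      rw [Matrix.mul_neg, trace_neg, hd]
      simp [dephase, Matrix.trace, Matrix.diagonal_mul]
    rw [e, Complex.neg_re] at this
    linarith
  have a2 : ((τ * W).trace).re ≤ 1 := by
    have := aux_trace_mul_nonneg hτ.1 h2
    rw [Matrix.mul_sub, Matrix.mul_one, trace_sub, hτ.2, Complex.sub_re, Complex.one_re] at this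
    linarith
  rw [Matrix.add_mul, smul_mul_assoc, smul_mul_assoc, trace_add, trace_smul, trace_smul,
    Complex.add_re, Complex.smul_re, Complex.smul_re, smul_eq_mul, smul_eq_mul]
  nlinarith

theorem cohWeight_SDP_dual {d : ℕ}
    (ρ : Matrix (Fin d) (Fin d) ℂ) (hρ : IsDensity ρ) :
    IsGreatest {x : ℝ | ∃ W : Matrix (Fin d) (Fin d) ℂ, W.IsHermitian ∧
        (-(dephase W)).PosSemidef ∧
        ((1 : Matrix (Fin d) (Fin d) ℂ) - W).PosSemidef ∧
        x = ((ρ * W).trace).re}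
      (cohWeight ρ) := by

  constructor
  · have hne : Nonempty (Fin d) := by
      by_contra h
      rw [not_nonempty_iff] at h
      have := hρ.2
      simp [Matrix.trace] at this
    obtain ⟨p, Y, hp, hpρ, hY, hY1, htr⟩ := aux_core hρ.1
    have hW1 : (-(dephase (1 - Y))).PosSemidef := by
      unfold dephase
      rw [diagonal_neg, posSemidef_diagonal_iff]
      intro i
      obtain ⟨-, a2⟩ := Complex.le_def.1 (hY.diag_nonneg (i := i))
      rw [Complex.le_def]
      have a1 := hY1 i
      simp only [Complex.zero_im] at a2
      simp [← a2]
      exact a1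
    have hW2 : ((1 : Matrix (Fin d) (Fin d) ℂ) - (1 - Y)).PosSemidef := by
      rw [sub_sub_cancel]; exact hY
    refine ⟨1 - Y, isHermitian_one.sub hY.1, hW1, hW2, le_antisymm ?_ (aux_weak hρ _ hW1 hW2)⟩
    have hb : cohWeight ρ ≤ 1 - ∑ i, p i :=
      csInf_le ⟨0, fun s hs => hs.1.1⟩ (aux_mem hρ p hp hpρ)
    rw [Matrix.mul_sub, Matrix.mul_one, trace_sub, hρ.2, Complex.sub_re, Complex.one_re]
    linarith
  · rintro x ⟨W, -, h1, h2, rfl⟩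
    exact aux_weak hρ W h1 h2
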